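/- Let φ : ℝ → ℝ be continuous with φ(x) = 0 for x ≤ 0, φ(x) = 1 for x ≥ 1, and φ continuously differentiable on [0,1], with ‖φ'‖_∞ := sup_{t∈[0,1]} |φ'(t)| > 0. Let r be a positive integer with r > 6‖φ'‖_∞² − (3/2)‖φ'‖_∞, set a_j := φ(j/r) for all j ∈ ℕ, and assume S_r^{(a)}(x,y) ≥ 0 for all (x,y) ∈ [−1,1]². Let N ∈ ℕ and 0 ≤ k ≤ r. Then for any univariate real polynomial Q such that Q(x) = ∫_{−1}^{1} T_k(y)·S_r^{(a)}(x,y)² dμ(y) for all x ∈ ℝ, one has ‖p_{r,N}^{(a)}·Q − T_k‖_{1,cheb} ≤ (N+1)/(1 − 4‖φ'‖_∞ + 2r/(3‖φ'‖_∞)) · (φ(k/r)² + (3k²/(2r))·‖φ'‖_∞²) + √(2((N+2)r+1))·(1/2)^N. -/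

import Mathlib

open Polynomial MeasureTheory

/-- The k-th Chebyshev polynomial of the first kind over ℝ. -/
noncomputable def chebT (k : ℕ) : Polynomial ℝ := Polynomial.Chebyshev.T ℝ (k : ℤ)

/-- The Chebyshev 1-norm of a univariate real polynomial: the sum of the absolute
values of the coefficients in the (unique) expansion in the Chebyshev basis. -/
noncomputable def cheb1Norm (p : Polynomial ℝ) : ℝ :=
  sInf {s : ℝ | ∃ c : ℕ →₀ ℝ,
    p = c.sum (fun j coef => Polynomial.C coef * chebT j) ∧ s = c.sum (fun _ coef => |coef|)}

/-- The Chebyshev probability measure on `[-1,1]`, `dμ(y) = dy/(π √(1-y²))`. -/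
noncomputable def chebMeasure : Measure ℝ :=
  (volume.restrict (Set.Icc (-1 : ℝ) 1)).withDensity
    (fun y => ENNReal.ofReal (1 / (Real.pi * Real.sqrt (1 - y ^ 2))))

/-- The kernel `S_r^{(a)}(x,y) = 1 + 2∑_{j=1}^r (1-a_j) T_j(x) T_j(y)`. -/
noncomputable def Sker (r : ℕ) (a : ℕ → ℝ) (x y : ℝ) : ℝ :=
  1 + 2 * ∑ j ∈ Finset.Icc 1 r, (1 - a j) * (chebT j).eval x * (chebT j).eval y

/-- `M_r^{(a)}` as a polynomial, `M_r^{(a)} = 1 + 2∑_{j=1}^r (1-a_j)² T_j²`. -/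
noncomputable def MPoly (r : ℕ) (a : ℕ → ℝ) : Polynomial ℝ :=
  1 + Polynomial.C 2 * ∑ j ∈ Finset.Icc 1 r, Polynomial.C ((1 - a j) ^ 2) * (chebT j) ^ 2

/-- `C = 1 + 2∑_{j=1}^r (1-a_j)²`. -/
noncomputable def Cval (r : ℕ) (a : ℕ → ℝ) : ℝ := 1 + 2 * ∑ j ∈ Finset.Icc 1 r, (1 - a j) ^ 2

/-- The polynomial `p_{r,N}^{(a)} = (1/C) ∑_{m=0}^{N} (1 - M_r^{(a)}/C)^m`. -/
noncomputable def pPoly (r : ℕ) (a : ℕ → ℝ) (N : ℕ) : Polynomial ℝ :=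
  Polynomial.C (1 / Cval r a) *
    ∑ m ∈ Finset.range (N + 1), ((1 : Polynomial ℝ) - Polynomial.C (1 / Cval r a) * MPoly r a) ^ m

/-- The sup-norm of the derivative of `φ` on `[0,1]` (derivative taken within `[0,1]`). -/
noncomputable def phiDerivSup (φ : ℝ → ℝ) : ℝ :=
  ⨆ t : Set.Icc (0 : ℝ) 1, |derivWithin φ (Set.Icc 0 1) t|

open Polynomial.Chebyshev in
/-- `chebMeasure` is the normalization of Mathlib's Chebyshev measure. -/
lemma chebMeasure_eq_smul_measureT :
    chebMeasure = ENNReal.ofReal Real.pi⁻¹ • measureT := by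
  rw [chebMeasure, measureT, restrict_withDensity measurableSet_Ioc,
    ← withDensity_smul _ (by fun_prop), Measure.restrict_congr_set Ioc_ae_eq_Icc.symm]
  congr 1
  ext y
  have h : (0 : ℝ) ≤ Real.sqrt (1 - y ^ 2)⁻¹ := by positivity
  have h2 : ENNReal.ofNNReal (.mk (Real.sqrt (1 - y ^ 2)⁻¹) h)
      = ENNReal.ofReal (Real.sqrt (1 - y ^ 2)⁻¹) := by
    rw [ENNReal.ofReal]; congr 1; ext; simp
  simp only [Pi.smul_apply, smul_eq_mul]
  rw [h2, ← ENNReal.ofReal_mul (by positivity)]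
  congr 1
  rw [Real.sqrt_inv, one_div, mul_inv]

lemma integrable_eval_chebMeasure (p : ℝ[X]) : Integrable (fun y => p.eval y) chebMeasure := by
  rw [chebMeasure_eq_smul_measureT]
  exact (Polynomial.Chebyshev.integrable_measureT (by fun_prop)).smul_measure (by simp)

/-- Integration of polynomials against the Chebyshev measure. -/
noncomputable def chebInt : ℝ[X] →ₗ[ℝ] ℝ where
  toFun p := ∫ y, p.eval y ∂chebMeasure
  map_add' p q := by
    simp only [eval_add]
    exact integral_add (integrable_eval_chebMeasure p) (integrable_eval_chebMeasure q)
  map_smul' c p := by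
    simp only [eval_smul, smul_eq_mul, RingHom.id_apply]
    exact integral_const_mul _ _

lemma chebInt_apply (p : ℝ[X]) : chebInt p = ∫ y, p.eval y ∂chebMeasure := rfl

lemma chebInt_T (n : ℤ) : chebInt (Chebyshev.T ℝ n) = if n = 0 then 1 else 0 := by
  rw [chebInt_apply, chebMeasure_eq_smul_measureT, integral_smul_measure]
  split_ifs with h
  · subst h
    rw [Chebyshev.integral_eval_T_real_measureT_zero, ENNReal.toReal_ofReal (by positivity),
      smul_eq_mul, inv_mul_cancel₀ Real.pi_ne_zero]
  · rw [Chebyshev.integral_eval_T_real_measureT_of_ne_zero h, smul_zero]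

lemma chebInt_nonneg {p : ℝ[X]} (hp : ∀ x ∈ Set.Icc (-1 : ℝ) 1, 0 ≤ p.eval x) :
    0 ≤ chebInt p := by
  refine integral_nonneg_of_ae ?_
  have h : ∀ᵐ x ∂chebMeasure, x ∈ Set.Icc (-1 : ℝ) 1 :=
    (withDensity_absolutelyContinuous _ _).ae_le (ae_restrict_mem measurableSet_Icc)
  filter_upwards [h] with x hx using hp x hx

lemma T_mul_T_eq (m k : ℤ) : Chebyshev.T ℝ m * Chebyshev.T ℝ k =
    (1 / 2 : ℝ) • Chebyshev.T ℝ (m + k) + (1 / 2 : ℝ) • Chebyshev.T ℝ (m - k) := by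
  rw [← smul_add, ← Chebyshev.T_mul_T, mul_assoc, two_mul, ← two_smul ℝ, smul_smul]
  norm_num

lemma chebInt_T_mul_T (m k : ℤ) : chebInt (Chebyshev.T ℝ m * Chebyshev.T ℝ k) =
    1 / 2 * (if k = -m then 1 else 0) + 1 / 2 * (if k = m then 1 else 0) := by
  rw [T_mul_T_eq, map_add, map_smul, map_smul, chebInt_T, chebInt_T, smul_eq_mul, smul_eq_mul]
  congr 3 <;> grind

/-! ### The Chebyshev `1`-norm -/

/-- The Chebyshev polynomials as a basis of `ℝ[X]`. -/
noncomputable def chebBasis : Module.Basis ℕ ℝ ℝ[X] :=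
  (Chebyshev.chebyshevTsequence ℝ).basis fun i => by
    rw [isUnit_iff_ne_zero]; exact leadingCoeff_ne_zero.2 (Chebyshev.T_ne_zero ℝ i)

lemma chebBasis_apply (j : ℕ) : chebBasis j = chebT j := by
  rw [chebBasis, Polynomial.Sequence.basis_eq_self]; rfl

lemma cheb1Norm_eq_repr (p : ℝ[X]) :
    cheb1Norm p = (chebBasis.repr p).sum fun _ coef => |coef| := by
  have key : ∀ c : ℕ →₀ ℝ, c.sum (fun j coef => Polynomial.C coef * chebT j)
      = chebBasis.repr.symm c := by
    intro c
    simp [Module.Basis.repr_symm_apply, Finsupp.linearCombination_apply, chebBasis_apply,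
      smul_eq_C_mul]
  have hset : {s : ℝ | ∃ c : ℕ →₀ ℝ, p = c.sum (fun j coef => Polynomial.C coef * chebT j) ∧
      s = c.sum (fun _ coef => |coef|)} = {(chebBasis.repr p).sum fun _ coef => |coef|} := by
    ext s
    simp only [key, Set.mem_ofPred_eq, Set.mem_singleton_iff]
    constructor
    · rintro ⟨c, rfl, rfl⟩; simp
    · rintro rfl; exact ⟨chebBasis.repr p, by simp, rfl⟩
  rw [cheb1Norm, hset, csInf_singleton]

lemma cheb1Norm_nonneg (p : ℝ[X]) : 0 ≤ cheb1Norm p := by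
  rw [cheb1Norm_eq_repr]; exact Finsupp.sum_nonneg fun _ _ => abs_nonneg _

lemma cheb1Norm_add_le (p q : ℝ[X]) : cheb1Norm (p + q) ≤ cheb1Norm p + cheb1Norm q := by
  classical
  simp only [cheb1Norm_eq_repr, map_add]
  set c := chebBasis.repr p
  set d := chebBasis.repr q
  rw [Finsupp.sum_of_support_subset (s := c.support ∪ d.support) _ Finsupp.support_add _ (by simp),
    Finsupp.sum_of_support_subset c Finset.subset_union_left _ (by simp),
    Finsupp.sum_of_support_subset d Finset.subset_union_right _ (by simp),
    ← Finset.sum_add_distrib]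
  exact Finset.sum_le_sum fun i _ => abs_add_le _ _

lemma cheb1Norm_smul (a : ℝ) (p : ℝ[X]) : cheb1Norm (a • p) = |a| * cheb1Norm p := by
  simp only [cheb1Norm_eq_repr, map_smul]
  rw [Finsupp.sum_smul_index' (by simp), Finsupp.mul_sum]
  simp [abs_mul]

lemma cheb1Norm_zero : cheb1Norm 0 = 0 := by simp [cheb1Norm_eq_repr]

lemma cheb1Norm_sum_le {ι : Type*} (s : Finset ι) (f : ι → ℝ[X]) :
    cheb1Norm (∑ i ∈ s, f i) ≤ ∑ i ∈ s, cheb1Norm (f i) :=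
  Finset.le_sum_of_subadditive _ cheb1Norm_zero.le cheb1Norm_add_le _ _

lemma cheb1Norm_T (n : ℤ) : cheb1Norm (Chebyshev.T ℝ n) = 1 := by
  rw [← Chebyshev.T_natAbs]
  change cheb1Norm (chebT n.natAbs) = 1
  rw [cheb1Norm_eq_repr, ← chebBasis_apply, Module.Basis.repr_self,
    Finsupp.sum_single_index (by simp), abs_one]

lemma cheb1Norm_T_mul_T_le (m k : ℤ) :
    cheb1Norm (Chebyshev.T ℝ m * Chebyshev.T ℝ k) ≤ 1 := by
  rw [T_mul_T_eq]
  refine (cheb1Norm_add_le _ _).trans ?_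
  rw [cheb1Norm_smul, cheb1Norm_smul, cheb1Norm_T, cheb1Norm_T]
  norm_num

lemma cheb1Norm_mul_le (p q : ℝ[X]) : cheb1Norm (p * q) ≤ cheb1Norm p * cheb1Norm q := by
  set c := chebBasis.repr p with hc
  set d := chebBasis.repr q with hd
  have hp : p = ∑ i ∈ c.support, c i • chebT i := by
    conv_lhs => rw [← chebBasis.linearCombination_repr p, Finsupp.linearCombination_apply,
      Finsupp.sum]
    simp [chebBasis_apply, hc]
  have hq : q = ∑ i ∈ d.support, d i • chebT i := by
    conv_lhs => rw [← chebBasis.linearCombination_repr q, Finsupp.linearCombination_apply,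
      Finsupp.sum]
    simp [chebBasis_apply, hd]
  rw [cheb1Norm_eq_repr p, cheb1Norm_eq_repr q, ← hc, ← hd, Finsupp.sum, Finsupp.sum,
    Finset.sum_mul_sum]
  conv_lhs => rw [hp, hq, Finset.sum_mul_sum]
  refine (cheb1Norm_sum_le _ _).trans (Finset.sum_le_sum fun i _ => ?_)
  refine (cheb1Norm_sum_le _ _).trans (Finset.sum_le_sum fun j _ => ?_)
  rw [smul_mul_smul_comm, cheb1Norm_smul, abs_mul]
  exact mul_le_of_le_one_right (by positivity) (cheb1Norm_T_mul_T_le i j)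

lemma cheb1Norm_pow_le_one {p : ℝ[X]} (hp : cheb1Norm p ≤ 1) (m : ℕ) :
    cheb1Norm (p ^ m) ≤ 1 := by
  induction m with
  | zero => rw [pow_zero, ← Chebyshev.T_zero, cheb1Norm_T]
  | succ m ih =>
    rw [pow_succ]
    exact (cheb1Norm_mul_le _ _).trans (mul_le_one₀ ih (cheb1Norm_nonneg _) hp)

lemma exists_chebT_expansion {p : ℝ[X]} {d : ℕ} (hp : p.natDegree ≤ d) :
    ∃ c : ℕ → ℝ, p = ∑ j ∈ Finset.range (d + 1), c j • chebT j := by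
  have h := (Chebyshev.chebyshevTsequence ℝ).span_degreeLE (m := d) fun i _ => by
    rw [isUnit_iff_ne_zero]; exact leadingCoeff_ne_zero.2 (Chebyshev.T_ne_zero ℝ i)
  have hmem : p ∈ degreeLE ℝ d := mem_degreeLE.2 (natDegree_le_iff_degree_le.1 hp)
  rw [← h] at hmem
  have h3 : (Set.Iic d : Set ℕ) = ((Finset.range (d + 1) : Finset ℕ) : Set ℕ) := by
    ext; simp
  rw [h3, Submodule.mem_span_image_finset_iff_exists_fun'] at hmem
  obtain ⟨c, hc⟩ := hmem
  exact ⟨c, hc.symm⟩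

lemma cheb1Norm_le_of_abs_eval_le {p : ℝ[X]} {d : ℕ} (hp : p.natDegree ≤ d) {ε : ℝ} (hε : 0 ≤ ε)
    (hb : ∀ x ∈ Set.Icc (-1 : ℝ) 1, |p.eval x| ≤ ε) :
    cheb1Norm p ≤ Real.sqrt (2 * (d + 1)) * ε := by
  obtain ⟨c, hc⟩ := exists_chebT_expansion hp
  have hnorm : cheb1Norm p ≤ ∑ j ∈ Finset.range (d + 1), |c j| := by
    conv_lhs => rw [hc]
    refine (cheb1Norm_sum_le _ _).trans (Finset.sum_le_sum fun j _ => ?_)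
    rw [cheb1Norm_smul, chebT, cheb1Norm_T, mul_one]
  have hsq : chebInt (p * p) ≤ ε ^ 2 := by
    have h := chebInt_nonneg (p := ε ^ 2 • Chebyshev.T ℝ 0 - p * p) fun x hx => by
      have := abs_le.1 (hb x hx)
      simp only [eval_sub, eval_smul, Chebyshev.T_zero, eval_one, eval_mul, smul_eq_mul]
      nlinarith
    rw [map_sub, map_smul, chebInt_T] at h
    simp at h
    linarith
  have hpar : 1 / 2 * ∑ j ∈ Finset.range (d + 1), c j ^ 2 ≤ chebInt (p * p) := by
    rw [hc, Finset.sum_mul_sum, map_sum, Finset.mul_sum]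
    refine Finset.sum_le_sum fun i hi => ?_
    rw [map_sum, Finset.sum_eq_single_of_mem i hi]
    · rw [smul_mul_smul_comm, map_smul, chebT, chebInt_T_mul_T, smul_eq_mul, if_pos rfl]
      have : (0 : ℝ) ≤ if (i : ℤ) = -i then 1 else 0 := by positivity
      nlinarith [mul_nonneg (mul_self_nonneg (c i)) this]
    · intro j _ hj
      rw [smul_mul_smul_comm, map_smul, chebT, chebT, chebInt_T_mul_T, if_neg (by lia),
        if_neg (by lia)]
      simp
  refine hnorm.trans ?_
  have hcs := sq_sum_le_card_mul_sum_sq (s := Finset.range (d + 1)) (f := fun j => |c j|)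
  simp only [sq_abs, Finset.card_range] at hcs
  refine abs_le_of_sq_le_sq' ?_ (by positivity) |>.2
  rw [mul_pow, Real.sq_sqrt (by positivity)]
  push_cast at hcs
  nlinarith

/-! ### The kernel as a sum over `ℤ` -/

/-- The even extension to `ℤ` of the coefficients `1 - a j` of the kernel. -/
def kerCoeff (a : ℕ → ℝ) (i : ℤ) : ℝ := 1 - a i.natAbs

lemma kerCoeff_neg (a : ℕ → ℝ) (i : ℤ) : kerCoeff a (-i) = kerCoeff a i := by simp [kerCoeff]

lemma kerCoeff_natCast (a : ℕ → ℝ) (j : ℕ) : kerCoeff a j = 1 - a j := by simp [kerCoeff]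

lemma kerCoeff_zero {a : ℕ → ℝ} (ha0 : a 0 = 0) : kerCoeff a 0 = 1 := by simp [kerCoeff, ha0]

lemma kerCoeff_eq_zero {r : ℕ} {a : ℕ → ℝ} (ha : ∀ j, r < j → a j = 1) {i : ℤ}
    (hi : i ∉ Finset.Icc (-(r : ℤ)) r) : kerCoeff a i = 0 := by
  rw [kerCoeff, ha _ (by rw [Finset.mem_Icc] at hi; lia), sub_self]

lemma sum_Icc_neg_of_even (r : ℕ) {f : ℤ → ℝ} (hf : ∀ i, f (-i) = f i) :
    ∑ i ∈ Finset.Icc (-(r : ℤ)) r, f i = f 0 + 2 * ∑ j ∈ Finset.Icc 1 r, f (j : ℤ) := by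
  induction r with
  | zero => simp
  | succ r ih =>
    have h : Finset.Icc (-((r + 1 : ℕ) : ℤ)) ((r + 1 : ℕ) : ℤ) =
        insert (-((r + 1 : ℕ) : ℤ)) (insert ((r + 1 : ℕ) : ℤ) (Finset.Icc (-(r : ℤ)) r)) := by
      ext i; simp only [Finset.mem_insert, Finset.mem_Icc]; lia
    rw [h, Finset.sum_insert (by simp only [Finset.mem_insert, Finset.mem_Icc]; lia),
      Finset.sum_insert (by simp only [Finset.mem_Icc]; lia), ih, hf,
      Finset.sum_Icc_succ_top (by lia)]
    ring

lemma sum_Icc_neg_comp_neg (r : ℕ) (f : ℤ → ℝ) :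
    ∑ i ∈ Finset.Icc (-(r : ℤ)) r, f (-i) = ∑ i ∈ Finset.Icc (-(r : ℤ)) r, f i :=
  Finset.sum_nbij' (fun i => -i) (fun i => -i) (by simp; lia) (by simp; lia) (by simp) (by simp)
    (by simp)

lemma sum_Icc_comp_sub (r k : ℕ) (f : ℤ → ℝ) :
    ∑ i ∈ Finset.Icc (-(r : ℤ)) (r + k), f (k - i) = ∑ i ∈ Finset.Icc (-(r : ℤ)) (r + k), f i :=
  Finset.sum_nbij' (fun i => k - i) (fun i => k - i) (by simp; lia) (by simp; lia) (by simp)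
    (by simp) (by simp)

/-- The kernel `Sker r a x ·` as a polynomial. -/
noncomputable def kerPoly (r : ℕ) (a : ℕ → ℝ) (x : ℝ) : ℝ[X] :=
  ∑ i ∈ Finset.Icc (-(r : ℤ)) r, (kerCoeff a i * (Chebyshev.T ℝ i).eval x) • Chebyshev.T ℝ i

lemma eval_kerPoly {r : ℕ} {a : ℕ → ℝ} (ha0 : a 0 = 0) (x y : ℝ) :
    (kerPoly r a x).eval y = Sker r a x y := by
  rw [kerPoly, eval_finsetSum]
  simp only [eval_smul, smul_eq_mul]
  rw [sum_Icc_neg_of_even _ (by intro i; simp only [kerCoeff_neg, Chebyshev.T_neg]), Sker]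
  simp [kerCoeff_natCast, kerCoeff_zero ha0, chebT]

lemma chebInt_T_mul_kerPoly {r : ℕ} {a : ℕ → ℝ} (ha : ∀ j, r < j → a j = 1) (x : ℝ) (m : ℤ) :
    chebInt (Chebyshev.T ℝ m * kerPoly r a x) = kerCoeff a m * (Chebyshev.T ℝ m).eval x := by
  rw [kerPoly, Finset.mul_sum, map_sum]
  simp only [mul_smul_comm, map_smul, chebInt_T_mul_T, smul_eq_mul, mul_add, Finset.sum_add_distrib,
    mul_ite, mul_one, mul_zero, Finset.sum_ite_eq']
  have h1 : (if m ∈ Finset.Icc (-(r : ℤ)) r then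
      kerCoeff a m * (Chebyshev.T ℝ m).eval x * (1 / 2) else 0) =
      kerCoeff a m * (Chebyshev.T ℝ m).eval x * (1 / 2) := by
    split_ifs with h
    · rfl
    · simp [kerCoeff_eq_zero ha h]
  have h2 : (-m ∈ Finset.Icc (-(r : ℤ)) r) ↔ m ∈ Finset.Icc (-(r : ℤ)) r := by
    simp only [Finset.mem_Icc]; lia
  simp only [kerCoeff_neg, Chebyshev.T_neg, h2, h1]
  ring

lemma sum_kerCoeff_sq_mul_T_nonneg {r : ℕ} {a : ℕ → ℝ} (ha0 : a 0 = 0)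
    (ha : ∀ j, r < j → a j = 1)
    (hS : ∀ x ∈ Set.Icc (-1 : ℝ) 1, ∀ y ∈ Set.Icc (-1 : ℝ) 1, 0 ≤ Sker r a x y)
    {x : ℝ} (hx : x ∈ Set.Icc (-1 : ℝ) 1) :
    0 ≤ ∑ i ∈ Finset.Icc (-(r : ℤ)) r, kerCoeff a i ^ 2 * (Chebyshev.T ℝ i).eval x := by
  have h : chebInt (kerPoly r a 1 * kerPoly r a x) =
      ∑ i ∈ Finset.Icc (-(r : ℤ)) r, kerCoeff a i ^ 2 * (Chebyshev.T ℝ i).eval x := by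
    rw [kerPoly, Finset.sum_mul, map_sum]
    refine Finset.sum_congr rfl fun i _ => ?_
    rw [smul_mul_assoc, map_smul, chebInt_T_mul_kerPoly ha, Chebyshev.T_eval_one, smul_eq_mul]
    ring
  rw [← h]
  refine chebInt_nonneg fun y hy => ?_
  rw [eval_mul, eval_kerPoly ha0, eval_kerPoly ha0]
  exact mul_nonneg (hS 1 (by simp) y hy) (hS x hx y hy)

lemma Cval_eq_sum {r : ℕ} {a : ℕ → ℝ} (ha0 : a 0 = 0) :
    Cval r a = ∑ i ∈ Finset.Icc (-(r : ℤ)) r, kerCoeff a i ^ 2 := by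
  rw [sum_Icc_neg_of_even _ (by intro i; simp only [kerCoeff_neg]), Cval]
  simp [kerCoeff_natCast, kerCoeff_zero ha0]

lemma one_le_Cval (r : ℕ) (a : ℕ → ℝ) : 1 ≤ Cval r a := by
  have : 0 ≤ ∑ j ∈ Finset.Icc 1 r, (1 - a j) ^ 2 := Finset.sum_nonneg fun _ _ => sq_nonneg _
  rw [Cval]; linarith

lemma eval_MPoly {r : ℕ} {a : ℕ → ℝ} (ha0 : a 0 = 0) (x : ℝ) : (MPoly r a).eval x =
    ∑ i ∈ Finset.Icc (-(r : ℤ)) r, kerCoeff a i ^ 2 * (Chebyshev.T ℝ i).eval x ^ 2 := by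
  rw [sum_Icc_neg_of_even _ (by intro i; simp only [kerCoeff_neg, Chebyshev.T_neg]), MPoly]
  simp [kerCoeff_natCast, kerCoeff_zero ha0, chebT, eval_finsetSum]

lemma eval_T_mul_eval_T (m k : ℤ) (x : ℝ) :
    (Chebyshev.T ℝ m).eval x * (Chebyshev.T ℝ k).eval x =
      1 / 2 * (Chebyshev.T ℝ (m + k)).eval x + 1 / 2 * (Chebyshev.T ℝ (m - k)).eval x := by
  simpa using congrArg (eval x) (T_mul_T_eq m k)

lemma eval_MPoly_le {r : ℕ} {a : ℕ → ℝ} (ha0 : a 0 = 0) {x : ℝ} (hx : x ∈ Set.Icc (-1 : ℝ) 1) :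
    (MPoly r a).eval x ≤ Cval r a := by
  rw [eval_MPoly ha0, Cval_eq_sum ha0]
  refine Finset.sum_le_sum fun i _ => mul_le_of_le_one_right (sq_nonneg _) ?_
  rw [sq_le_one_iff_abs_le_one]
  exact Chebyshev.abs_eval_T_real_le_one i (abs_le.2 hx)

lemma half_Cval_le_eval_MPoly {r : ℕ} {a : ℕ → ℝ} (ha0 : a 0 = 0) (ha : ∀ j, r < j → a j = 1)
    (hS : ∀ x ∈ Set.Icc (-1 : ℝ) 1, ∀ y ∈ Set.Icc (-1 : ℝ) 1, 0 ≤ Sker r a x y)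
    {x : ℝ} (hx : x ∈ Set.Icc (-1 : ℝ) 1) : Cval r a / 2 ≤ (MPoly r a).eval x := by
  have h2 := sum_kerCoeff_sq_mul_T_nonneg ha0 ha hS (Chebyshev.eval_T_real_mem_Icc 2 hx)
  have h : (MPoly r a).eval x = Cval r a / 2 + 1 / 2 * ∑ i ∈ Finset.Icc (-(r : ℤ)) r,
      kerCoeff a i ^ 2 * (Chebyshev.T ℝ i).eval ((Chebyshev.T ℝ 2).eval x) := by
    rw [eval_MPoly ha0, Cval_eq_sum ha0, Finset.sum_div, Finset.mul_sum, ← Finset.sum_add_distrib]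
    refine Finset.sum_congr rfl fun i _ => ?_
    rw [pow_two (eval x _), eval_T_mul_eval_T, sub_self, ← eval_comp, ← Chebyshev.T_mul, mul_two]
    simp
    ring
  linarith

/-! ### Bounds for `pPoly` -/

lemma cheb1Norm_one_sub_MPoly_le (r : ℕ) (a : ℕ → ℝ) :
    cheb1Norm (1 - C (1 / Cval r a) * MPoly r a) ≤ 1 := by
  have hC := one_le_Cval r a
  have h : 1 - C (1 / Cval r a) * MPoly r a = (1 / Cval r a) •
      ∑ j ∈ Finset.Icc 1 r, (2 * (1 - a j) ^ 2) • (1 - chebT j * chebT j) := by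
    refine Polynomial.funext fun x => ?_
    simp only [MPoly, eval_sub, eval_one, eval_mul, eval_C, eval_add, eval_finsetSum, eval_pow,
      eval_smul, smul_eq_mul]
    rw [eq_comm, ← sub_eq_zero, ← mul_left_cancel_iff_of_pos (show 0 < Cval r a by linarith)]
    field_simp
    rw [Cval]
    simp only [mul_sub, Finset.mul_sum, Finset.sum_sub_distrib]
    ring_nf
  rw [h, cheb1Norm_smul, abs_of_pos (by positivity), div_mul_eq_mul_div, one_mul,
    div_le_one (by linarith)]
  refine (cheb1Norm_sum_le _ _).trans ?_
  have h2 : ∀ j, cheb1Norm ((2 * (1 - a j) ^ 2) • (1 - chebT j * chebT j)) ≤ 2 * (1 - a j) ^ 2 := by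
    intro j
    have h3 : 1 - chebT j * chebT j = (1 / 2 : ℝ) • Chebyshev.T ℝ 0 +
        (-(1 / 2) : ℝ) • Chebyshev.T ℝ (j + j) := by
      rw [chebT, T_mul_T_eq, sub_self]
      refine Polynomial.funext fun x => ?_
      simp
      ring
    rw [cheb1Norm_smul, abs_of_nonneg (by positivity), h3]
    refine mul_le_of_le_one_right (by positivity) ((cheb1Norm_add_le _ _).trans ?_)
    rw [cheb1Norm_smul, cheb1Norm_smul, cheb1Norm_T, cheb1Norm_T]
    norm_num [abs_of_pos]
  refine (Finset.sum_le_sum fun j _ => h2 j).trans ?_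
  rw [← Finset.mul_sum, Cval]
  linarith

lemma cheb1Norm_pPoly_le (r : ℕ) (a : ℕ → ℝ) (N : ℕ) :
    cheb1Norm (pPoly r a N) ≤ (N + 1) / Cval r a := by
  have hC := one_le_Cval r a
  rw [pPoly, ← smul_eq_C_mul, cheb1Norm_smul, abs_of_pos (by positivity), div_mul_eq_mul_div,
    one_mul]
  gcongr
  refine (cheb1Norm_sum_le _ _).trans ((Finset.sum_le_sum fun m _ =>
    cheb1Norm_pow_le_one (cheb1Norm_one_sub_MPoly_le r a) m).trans ?_)
  simp

lemma pPoly_mul_MPoly (r : ℕ) (a : ℕ → ℝ) (N : ℕ) :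
    pPoly r a N * MPoly r a = 1 - (1 - C (1 / Cval r a) * MPoly r a) ^ (N + 1) := by
  rw [← mul_neg_geom_sum, pPoly]
  ring

lemma natDegree_MPoly_le (r : ℕ) (a : ℕ → ℝ) : (MPoly r a).natDegree ≤ 2 * r := by
  refine natDegree_add_le_of_degree_le (by simp) ((natDegree_C_mul_le _ _).trans ?_)
  refine natDegree_sum_le_of_forall_le _ _ fun j hj => (natDegree_C_mul_le _ _).trans ?_
  rw [natDegree_pow, chebT, Chebyshev.natDegree_T]
  rw [Finset.mem_Icc] at hj
  simp
  lia

lemma cheb1Norm_residual_mul_T_le {r : ℕ} {a : ℕ → ℝ} (ha0 : a 0 = 0) (ha : ∀ j, r < j → a j = 1)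
    (hS : ∀ x ∈ Set.Icc (-1 : ℝ) 1, ∀ y ∈ Set.Icc (-1 : ℝ) 1, 0 ≤ Sker r a x y) (N k : ℕ) :
    cheb1Norm ((1 - C (1 / Cval r a) * MPoly r a) ^ (N + 1) * chebT k) ≤
      Real.sqrt (2 * (((N + 1) * (2 * r) + k : ℕ) + 1)) * (1 / 2) ^ (N + 1) := by
  refine cheb1Norm_le_of_abs_eval_le (natDegree_mul_le_of_le (natDegree_pow_le_of_le _ ?_) ?_)
    (by positivity) fun x hx => ?_
  · exact (natDegree_sub_le _ _).trans
      (max_le (by simp) ((natDegree_C_mul_le _ _).trans (natDegree_MPoly_le r a)))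
  · exact (Chebyshev.natDegree_T ℝ k).le
  · have hC := one_le_Cval r a
    have h1 := eval_MPoly_le (r := r) ha0 hx
    have h2 := half_Cval_le_eval_MPoly ha0 ha hS hx
    rw [eval_mul, abs_mul, eval_pow, abs_pow]
    refine (mul_le_of_le_one_right (by positivity)
      (Chebyshev.abs_eval_T_real_le_one k (abs_le.2 hx))).trans ?_
    gcongr
    simp only [eval_sub, eval_one, eval_mul, eval_C]
    rw [one_div_mul_eq_div, abs_of_nonneg]
    · rw [sub_le_comm, le_div_iff₀ (by linarith)]; linarith
    · rw [sub_nonneg, div_le_one (by linarith)]; exact h1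

/-! ### The commutator term -/

lemma integral_chebT_mul_Sker_sq {r : ℕ} {a : ℕ → ℝ} (ha0 : a 0 = 0) (ha : ∀ j, r < j → a j = 1)
    (k : ℕ) (x : ℝ) :
    ∫ y, (chebT k).eval y * Sker r a x y ^ 2 ∂chebMeasure =
      ∑ i ∈ Finset.Icc (-(r : ℤ)) (r + k), kerCoeff a i * kerCoeff a (k - i) *
        ((Chebyshev.T ℝ i).eval x * (Chebyshev.T ℝ (k - i)).eval x) := by
  have h1 : ∫ y, (chebT k).eval y * Sker r a x y ^ 2 ∂chebMeasure =
      chebInt (∑ i ∈ Finset.Icc (-(r : ℤ)) r, (kerCoeff a i * (Chebyshev.T ℝ i).eval x) •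
        ((Chebyshev.T ℝ k * Chebyshev.T ℝ i) * kerPoly r a x)) := by
    rw [chebInt_apply]
    have e : chebT k * kerPoly r a x = ∑ i ∈ Finset.Icc (-(r : ℤ)) r,
        (kerCoeff a i * (Chebyshev.T ℝ i).eval x) • (Chebyshev.T ℝ k * Chebyshev.T ℝ i) := by
      rw [kerPoly, Finset.mul_sum]
      simp only [mul_smul_comm, chebT]
    simp only [← smul_mul_assoc, ← Finset.sum_mul]
    simp only [smul_mul_assoc, ← e, eval_mul, eval_kerPoly ha0, pow_two, mul_assoc]
  have h2 : ∀ i : ℤ, chebInt ((Chebyshev.T ℝ k * Chebyshev.T ℝ i) * kerPoly r a x) =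
      1 / 2 * (kerCoeff a (k - -i) * (Chebyshev.T ℝ (k - -i)).eval x) +
      1 / 2 * (kerCoeff a (k - i) * (Chebyshev.T ℝ (k - i)).eval x) := by
    intro i
    rw [T_mul_T_eq, add_mul, smul_mul_assoc, smul_mul_assoc, map_add, map_smul, map_smul,
      chebInt_T_mul_kerPoly ha, chebInt_T_mul_kerPoly ha, sub_neg_eq_add, smul_eq_mul, smul_eq_mul]
  have h3 := sum_Icc_neg_comp_neg r fun i => kerCoeff a i * (Chebyshev.T ℝ i).eval x *
    (1 / 2 * (kerCoeff a (k - i) * (Chebyshev.T ℝ (k - i)).eval x))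
  simp only [kerCoeff_neg, Chebyshev.T_neg] at h3
  rw [h1, map_sum]
  simp only [map_smul, h2, smul_eq_mul, mul_add, Finset.sum_add_distrib]
  rw [h3, ← Finset.sum_add_distrib]
  rw [← Finset.sum_subset (s₁ := Finset.Icc (-(r : ℤ)) r)
      (s₂ := Finset.Icc (-(r : ℤ)) (r + k))]
  · exact Finset.sum_congr rfl fun i _ => by ring
  · exact Finset.Icc_subset_Icc_right (by lia)
  · intro i _ hi
    rw [kerCoeff_eq_zero ha hi]; simp

lemma sub_MPoly_mul_chebT_eq {r : ℕ} {a : ℕ → ℝ} (ha0 : a 0 = 0) (ha : ∀ j, r < j → a j = 1)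
    (k : ℕ) {Q : ℝ[X]}
    (hQ : ∀ x : ℝ, Q.eval x = ∫ y, (chebT k).eval y * Sker r a x y ^ 2 ∂chebMeasure) :
    Q - MPoly r a * chebT k = ∑ i ∈ Finset.Icc (-(r : ℤ)) (r + k),
      (-(1 / 2) * (kerCoeff a i - kerCoeff a (k - i)) ^ 2) •
        (Chebyshev.T ℝ i * Chebyshev.T ℝ (k - i)) := by
  refine Polynomial.funext fun x => ?_
  have h1 : (MPoly r a).eval x * (chebT k).eval x = ∑ i ∈ Finset.Icc (-(r : ℤ)) (r + k),
      kerCoeff a i ^ 2 * ((Chebyshev.T ℝ i).eval x * (Chebyshev.T ℝ (k - i)).eval x) := by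
    have h3 := sum_Icc_neg_comp_neg r fun i =>
      1 / 4 * kerCoeff a i ^ 2 * (Chebyshev.T ℝ (k - (i + i))).eval x
    simp only [kerCoeff_neg] at h3
    rw [eval_MPoly ha0, Finset.sum_mul, ← Finset.sum_subset (s₁ := Finset.Icc (-(r : ℤ)) r)
      (s₂ := Finset.Icc (-(r : ℤ)) (r + k))]
    · calc
        _ = ∑ i ∈ Finset.Icc (-(r : ℤ)) r, (1 / 2 * kerCoeff a i ^ 2 * (Chebyshev.T ℝ k).eval x
              + 1 / 4 * kerCoeff a i ^ 2 * (Chebyshev.T ℝ (k - (i + i))).eval x) +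
            ∑ i ∈ Finset.Icc (-(r : ℤ)) r,
              1 / 4 * kerCoeff a i ^ 2 * (Chebyshev.T ℝ (k - (-i + -i))).eval x := by
          rw [← Finset.sum_add_distrib]
          refine Finset.sum_congr rfl fun i _ => ?_
          have e := eval_T_mul_eval_T k (i + i) x
          have e' : (k : ℤ) - (-i + -i) = k + (i + i) := by ring
          rw [e', chebT, pow_two (eval x _), eval_T_mul_eval_T, sub_self, Chebyshev.T_zero,
            eval_one]
          linear_combination 1 / 2 * kerCoeff a i ^ 2 * e
        _ = _ := by
          rw [h3, ← Finset.sum_add_distrib]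
          refine Finset.sum_congr rfl fun i _ => ?_
          rw [eval_T_mul_eval_T, add_sub_cancel, ← Chebyshev.T_neg ℝ (i - (k - i))]
          have e' : -(i - ((k : ℤ) - i)) = k - (i + i) := by ring
          rw [e']
          ring
    · exact Finset.Icc_subset_Icc_right (by lia)
    · intro i _ hi
      rw [kerCoeff_eq_zero ha hi]; simp
  have h2 := sum_Icc_comp_sub r k fun i =>
      kerCoeff a i ^ 2 * ((Chebyshev.T ℝ i).eval x * (Chebyshev.T ℝ (k - i)).eval x)
  simp only [sub_sub_cancel] at h2
  have h4 : (MPoly r a).eval x * (chebT k).eval x = ∑ i ∈ Finset.Icc (-(r : ℤ)) (r + k),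
      1 / 2 * (kerCoeff a i ^ 2 + kerCoeff a (k - i) ^ 2) *
        ((Chebyshev.T ℝ i).eval x * (Chebyshev.T ℝ (k - i)).eval x) := by
    have : ∀ p q : ℝ, p = q → p = 1 / 2 * (p + q) := by intro p q h; rw [h]; ring
    rw [h1, this _ _ h2.symm, ← Finset.sum_add_distrib, Finset.mul_sum]
    exact Finset.sum_congr rfl fun i _ => by ring
  rw [eval_sub, eval_mul, h4, hQ, integral_chebT_mul_Sker_sq ha0 ha, ← Finset.sum_sub_distrib,
    eval_finsetSum]
  refine Finset.sum_congr rfl fun i _ => ?_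
  simp only [eval_smul, eval_mul, smul_eq_mul]
  ring

/-- The error bound for general kernel coefficients `a`. -/
lemma cheb1Norm_pPoly_mul_sub_le {r : ℕ} {a : ℕ → ℝ} (ha0 : a 0 = 0) (ha : ∀ j, r < j → a j = 1)
    (hS : ∀ x ∈ Set.Icc (-1 : ℝ) 1, ∀ y ∈ Set.Icc (-1 : ℝ) 1, 0 ≤ Sker r a x y) (N k : ℕ)
    {Q : ℝ[X]}
    (hQ : ∀ x : ℝ, Q.eval x = ∫ y, (chebT k).eval y * Sker r a x y ^ 2 ∂chebMeasure) :
    cheb1Norm (pPoly r a N * Q - chebT k) ≤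
      (N + 1) / Cval r a * (1 / 2 * ∑ i ∈ Finset.Icc (-(r : ℤ)) (r + k),
        (kerCoeff a i - kerCoeff a (k - i)) ^ 2) +
      Real.sqrt (2 * (((N + 1) * (2 * r) + k : ℕ) + 1)) * (1 / 2) ^ (N + 1) := by
  have hC := one_le_Cval r a
  have hsplit : pPoly r a N * Q - chebT k = pPoly r a N * (Q - MPoly r a * chebT k) +
      (-1 : ℝ) • ((1 - C (1 / Cval r a) * MPoly r a) ^ (N + 1) * chebT k) := by
    rw [mul_sub, ← mul_assoc, pPoly_mul_MPoly, neg_one_smul]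
    ring
  rw [hsplit]
  refine (cheb1Norm_add_le _ _).trans (add_le_add ((cheb1Norm_mul_le _ _).trans ?_) ?_)
  · refine mul_le_mul (cheb1Norm_pPoly_le r a N) ?_ (cheb1Norm_nonneg _) (by positivity)
    rw [sub_MPoly_mul_chebT_eq ha0 ha k hQ, Finset.mul_sum]
    refine (cheb1Norm_sum_le _ _).trans (Finset.sum_le_sum fun i _ => ?_)
    rw [cheb1Norm_smul, abs_mul, abs_neg, abs_of_pos (by norm_num : (0 : ℝ) < 1 / 2),
      abs_of_nonneg (sq_nonneg _)]
    exact mul_le_of_le_one_right (by positivity) (cheb1Norm_T_mul_T_le _ _)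
  · rw [cheb1Norm_smul, abs_neg, abs_one, one_mul]
    exact cheb1Norm_residual_mul_T_le ha0 ha hS N k

/-! ### Coefficients sampled from `φ` -/

section Cutoff

variable {φ : ℝ → ℝ}

lemma abs_derivWithin_le_phiDerivSup (hC1 : ContDiffOn ℝ 1 φ (Set.Icc 0 1)) {t : ℝ}
    (ht : t ∈ Set.Icc (0 : ℝ) 1) : |derivWithin φ (Set.Icc 0 1) t| ≤ phiDerivSup φ := by
  have hc : ContinuousOn (fun t => |derivWithin φ (Set.Icc 0 1) t|) (Set.Icc 0 1) :=
    (hC1.continuousOn_derivWithin (uniqueDiffOn_Icc zero_lt_one) le_rfl).abs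
  have hb := isCompact_Icc.bddAbove_image hc
  rw [Set.image_eq_range] at hb
  exact le_ciSup hb ⟨t, ht⟩

lemma abs_sub_le_phiDerivSup_mul (h0 : ∀ x : ℝ, x ≤ 0 → φ x = 0) (h1 : ∀ x : ℝ, 1 ≤ x → φ x = 1)
    (hC1 : ContDiffOn ℝ 1 φ (Set.Icc 0 1)) (x y : ℝ) :
    |φ x - φ y| ≤ phiDerivSup φ * |x - y| := by
  have hL : 0 ≤ phiDerivSup φ := Real.iSup_nonneg fun _ => abs_nonneg _
  have hproj : ∀ x, φ (Set.projIcc (0 : ℝ) 1 zero_le_one x) = φ x := by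
    intro x
    rcases le_total x 0 with hx | hx
    · rw [Set.projIcc_of_le_left _ hx, h0 x hx, h0 _ le_rfl]
    · rcases le_total 1 x with hx' | hx'
      · rw [Set.projIcc_of_right_le _ hx', h1 x hx', h1 _ le_rfl]
      · rw [Set.projIcc_of_mem _ ⟨hx, hx'⟩]
  have hmv := (convex_Icc (0 : ℝ) 1).norm_image_sub_le_of_norm_derivWithin_le
    (hC1.differentiableOn one_ne_zero) (fun t ht => abs_derivWithin_le_phiDerivSup hC1 ht)
    (Set.projIcc (0 : ℝ) 1 zero_le_one y).2 (Set.projIcc (0 : ℝ) 1 zero_le_one x).2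
  rw [hproj, hproj, Real.norm_eq_abs, Real.norm_eq_abs] at hmv
  exact hmv.trans (mul_le_mul_of_nonneg_left (Set.abs_projIcc_sub_projIcc zero_le_one) hL)

lemma one_le_phiDerivSup (h0 : ∀ x : ℝ, x ≤ 0 → φ x = 0) (h1 : ∀ x : ℝ, 1 ≤ x → φ x = 1)
    (hC1 : ContDiffOn ℝ 1 φ (Set.Icc 0 1)) : 1 ≤ phiDerivSup φ := by
  simpa [h0 0 le_rfl, h1 1 le_rfl] using abs_sub_le_phiDerivSup_mul h0 h1 hC1 1 0

/-- Telescoping lower bound for the squares of a ramp of slope `-δ`. -/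
lemma one_le_three_mul_sum_sq_ramp {δ : ℝ} (hδ : 0 ≤ δ) {n : ℕ} (hn : 1 ≤ δ * n) :
    1 ≤ 3 * δ * ∑ j ∈ Finset.range n, max 0 (1 - δ * j) ^ 2 := by
  have h := Finset.sum_range_sub' (fun j : ℕ => max 0 (1 - δ * j) ^ 3) n
  rw [max_eq_left (b := 1 - δ * n) (by linarith)] at h
  simp only [Nat.cast_zero, mul_zero, sub_zero, max_eq_right zero_le_one, one_pow,
    ne_eq, OfNat.ofNat_ne_zero, not_false_eq_true, zero_pow] at h
  refine h.symm.trans_le ?_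
  rw [Finset.mul_sum]
  push_cast
  refine Finset.sum_le_sum fun j _ => ?_
  rcases le_total (1 - δ * j) 0 with hj | hj
  · rw [max_eq_left hj, max_eq_left (by nlinarith)]; simp
  rw [max_eq_right hj]
  rcases le_total (1 - δ * (j + 1)) 0 with hj' | hj'
  · rw [max_eq_left hj']
    nlinarith [mul_nonneg (sq_nonneg (1 - δ * j)) (show 0 ≤ δ - (1 - δ * j) by linarith),
      mul_nonneg (sq_nonneg (1 - δ * j)) hδ]
  · rw [max_eq_right hj']
    nlinarith [mul_nonneg (sq_nonneg δ) (show 0 ≤ 1 - δ * j by linarith),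
      mul_nonneg (sq_nonneg δ) hj', mul_nonneg (sq_nonneg δ) hδ]

lemma le_Cval_of_phi (h0 : ∀ x : ℝ, x ≤ 0 → φ x = 0) (h1 : ∀ x : ℝ, 1 ≤ x → φ x = 1)
    (hC1 : ContDiffOn ℝ 1 φ (Set.Icc 0 1)) {r : ℕ} (hr : 1 ≤ r) :
    2 * (r : ℝ) / (3 * phiDerivSup φ) - 1 ≤ Cval r (fun j => φ ((j : ℝ) / r)) := by
  have hL := one_le_phiDerivSup h0 h1 hC1
  set L := phiDerivSup φ with hLdef
  have hr0 : (0 : ℝ) < r := by exact_mod_cast hr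
  have hramp := one_le_three_mul_sum_sq_ramp (δ := L / r) (by positivity) (n := r)
    (by rw [div_mul_cancel₀ _ hr0.ne']; exact hL)
  have hle : ∑ j ∈ Finset.range r, max 0 (1 - L / r * j) ^ 2 ≤
      ∑ j ∈ Finset.range (r + 1), (1 - φ ((j : ℝ) / r)) ^ 2 := by
    rw [Finset.sum_range_succ]
    refine le_add_of_le_of_nonneg (Finset.sum_le_sum fun j _ => ?_) (sq_nonneg _)
    have hj := abs_sub_le_phiDerivSup_mul h0 h1 hC1 ((j : ℝ) / r) 0
    rw [h0 0 le_rfl, sub_zero, sub_zero, abs_of_nonneg (a := (j : ℝ) / r) (by positivity)] at hj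
    have hj' := (le_abs_self _).trans hj
    rw [← sq_abs (1 - φ _)]
    refine pow_le_pow_left₀ (le_max_left _ _) (max_le (abs_nonneg _) (le_trans ?_ (le_abs_self _))) 2
    have : L / r * j = L * (j / r) := by ring
    linarith
  have hC : Cval r (fun j => φ ((j : ℝ) / r)) =
      2 * ∑ j ∈ Finset.range (r + 1), (1 - φ ((j : ℝ) / r)) ^ 2 - 1 := by
    rw [Cval, Finset.range_eq_Ico, Finset.sum_eq_sum_Ico_succ_bot (by lia)]
    simp [h0 0 le_rfl, Finset.Ico_add_one_right_eq_Icc]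
    ring
  rw [hC]
  have hmul : (r : ℝ) / (3 * L) ≤ ∑ j ∈ Finset.range r, max 0 (1 - L / r * j) ^ 2 := by
    rw [div_le_iff₀ (by positivity)]
    have := mul_le_mul_of_nonneg_left hramp hr0.le
    calc (r : ℝ) = r * 1 := (mul_one _).symm
      _ ≤ _ := this
      _ = _ := by field_simp
  have : 2 * (r : ℝ) / (3 * L) = 2 * (r / (3 * L)) := by ring
  linarith

lemma sum_kerCoeff_sub_sq_le_of_phi (h0 : ∀ x : ℝ, x ≤ 0 → φ x = 0)
    (h1 : ∀ x : ℝ, 1 ≤ x → φ x = 1) (hC1 : ContDiffOn ℝ 1 φ (Set.Icc 0 1)) {r : ℕ} (hr : 1 ≤ r)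
    {k : ℕ} (hk : k ≤ r) :
    1 / 2 * ∑ i ∈ Finset.Icc (-(r : ℤ)) (r + k), (kerCoeff (fun j => φ ((j : ℝ) / r)) i -
        kerCoeff (fun j => φ ((j : ℝ) / r)) (k - i)) ^ 2 ≤
      φ ((k : ℝ) / r) ^ 2 + 3 * (k : ℝ) ^ 2 / (2 * r) * phiDerivSup φ ^ 2 := by
  set L := phiDerivSup φ with hLdef
  set β := kerCoeff (fun j => φ ((j : ℝ) / r)) with hβ
  have hr0 : (0 : ℝ) < r := by exact_mod_cast hr
  rcases Nat.eq_zero_or_pos k with rfl | hk0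
  · simp [hβ, kerCoeff_neg, h0 0 le_rfl]
  have hterm : ∀ i : ℤ, (β i - β (k - i)) ^ 2 ≤ (L * (k / r)) ^ 2 := by
    intro i
    rw [← sq_abs]
    refine pow_le_pow_left₀ (abs_nonneg _) ?_ 2
    have h := abs_sub_le_phiDerivSup_mul h0 h1 hC1 (((k - i : ℤ).natAbs : ℝ) / r)
      ((i.natAbs : ℝ) / r)
    have hd : |((k - i : ℤ).natAbs : ℝ) / r - (i.natAbs : ℝ) / r| ≤ k / r := by
      rw [← sub_div, abs_div, abs_of_pos hr0]
      gcongr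
      rw [abs_le]
      constructor
      · rw [neg_le_sub_iff_le_add]; exact_mod_cast (by lia : i.natAbs ≤ (k - i : ℤ).natAbs + k)
      · rw [sub_le_iff_le_add]; exact_mod_cast (by lia : (k - i : ℤ).natAbs ≤ k + i.natAbs)
    calc |β i - β (k - i)| = |φ (((k - i : ℤ).natAbs : ℝ) / r) - φ ((i.natAbs : ℝ) / r)| := by
          rw [hβ, kerCoeff, kerCoeff]; congr 1; ring
      _ ≤ L * (k / r) := h.trans (mul_le_mul_of_nonneg_left hd
          (zero_le_one.trans (one_le_phiDerivSup h0 h1 hC1)))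
  have hends : ∀ i ∈ ({0, (k : ℤ)} : Finset ℤ), (β i - β (k - i)) ^ 2 = φ ((k : ℝ) / r) ^ 2 := by
    intro i hi
    rw [Finset.mem_insert, Finset.mem_singleton] at hi
    rcases hi with rfl | rfl <;> simp [hβ, kerCoeff, h0 0 le_rfl]
  have hsub : ({0, (k : ℤ)} : Finset ℤ) ⊆ Finset.Icc (-(r : ℤ)) (r + k) := by
    intro i; simp only [Finset.mem_insert, Finset.mem_singleton, Finset.mem_Icc]; lia
  have hcard2 : ({0, (k : ℤ)} : Finset ℤ).card = 2 := Finset.card_pair (by lia)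
  have hcard : (Finset.Icc (-(r : ℤ)) (r + k) \ {0, (k : ℤ)}).card ≤ 3 * r := by
    rw [Finset.card_sdiff_of_subset hsub, hcard2, Int.card_Icc]; lia
  rw [← Finset.sum_sdiff hsub, Finset.sum_congr rfl hends, Finset.sum_const, hcard2]
  have hrest := Finset.sum_le_card_nsmul (Finset.Icc (-(r : ℤ)) (r + k) \ {0, (k : ℤ)}) _ _
    fun i _ => hterm i
  have hrest' : ∑ i ∈ Finset.Icc (-(r : ℤ)) (r + k) \ {0, (k : ℤ)}, (β i - β (k - i)) ^ 2 ≤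
      3 * r * (L * (k / r)) ^ 2 := by
    refine hrest.trans ?_
    rw [nsmul_eq_mul]
    gcongr
    exact_mod_cast hcard
  have he : 3 * (r : ℝ) * (L * (k / r)) ^ 2 = 2 * (3 * (k : ℝ) ^ 2 / (2 * r) * L ^ 2) := by
    field_simp
  rw [nsmul_eq_mul]
  push_cast
  linarith

end Cutoff

/-- main univariate error bound in terms of `φ`. -/
theorem cheb1Norm_pPoly_error_bound_phi (φ : ℝ → ℝ) (hcont : Continuous φ)
    (h0 : ∀ x : ℝ, x ≤ 0 → φ x = 0) (h1 : ∀ x : ℝ, 1 ≤ x → φ x = 1)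
    (hC1 : ContDiffOn ℝ 1 φ (Set.Icc 0 1)) (hpos : 0 < phiDerivSup φ)
    (r : ℕ) (hr : 1 ≤ r)
    (hrbig : 6 * (phiDerivSup φ) ^ 2 - (3 / 2) * phiDerivSup φ < (r : ℝ))
    (hS : ∀ x ∈ Set.Icc (-1 : ℝ) 1, ∀ y ∈ Set.Icc (-1 : ℝ) 1,
      0 ≤ Sker r (fun j => φ ((j : ℝ) / r)) x y)
    (N : ℕ) (k : ℕ) (hk : k ≤ r)
    (Q : Polynomial ℝ)
    (hQ : ∀ x : ℝ, Q.eval x =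
      ∫ y, (chebT k).eval y * (Sker r (fun j => φ ((j : ℝ) / r)) x y) ^ 2 ∂chebMeasure) :
    cheb1Norm (pPoly r (fun j => φ ((j : ℝ) / r)) N * Q - chebT k) ≤
      (((N : ℝ) + 1) / (1 - 4 * phiDerivSup φ + 2 * (r : ℝ) / (3 * phiDerivSup φ))) *
        (φ ((k : ℝ) / r) ^ 2 + (3 * (k : ℝ) ^ 2 / (2 * r)) * (phiDerivSup φ) ^ 2) +
      Real.sqrt (2 * (((N : ℝ) + 2) * r + 1)) * (1 / 2) ^ N := by
  set L := phiDerivSup φ with hLdef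
  have hr0 : (0 : ℝ) < r := by exact_mod_cast hr
  have ha0 : (fun j : ℕ => φ ((j : ℝ) / r)) 0 = 0 := h0 _ (by simp)
  have ha : ∀ j : ℕ, r < j → (fun j : ℕ => φ ((j : ℝ) / r)) j = 1 := fun j hj =>
    h1 _ ((one_le_div hr0).2 (by exact_mod_cast hj.le))
  have hL : 1 ≤ L := one_le_phiDerivSup h0 h1 hC1
  have hCval := le_Cval_of_phi h0 h1 hC1 hr
  rw [← hLdef] at hCval
  have hden : 0 < 1 - 4 * L + 2 * (r : ℝ) / (3 * L) := by
    have : 4 * L - 1 < 2 * (r : ℝ) / (3 * L) := by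
      rw [lt_div_iff₀ (by positivity)]; nlinarith
    linarith
  refine (cheb1Norm_pPoly_mul_sub_le ha0 ha hS N k hQ).trans (add_le_add ?_ ?_)
  · refine mul_le_mul ?_ (sum_kerCoeff_sub_sq_le_of_phi h0 h1 hC1 hr hk)
      (mul_nonneg (by norm_num) (Finset.sum_nonneg fun _ _ => sq_nonneg _)) (by positivity)
    gcongr
    linarith
  · have hsqrt : Real.sqrt (2 * (((N + 1) * (2 * r) + k : ℕ) + 1)) ≤
        2 * Real.sqrt (2 * (((N : ℝ) + 2) * r + 1)) := by
      rw [Real.sqrt_le_left (by positivity), mul_pow, Real.sq_sqrt (by positivity)]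
      have hkr : (k : ℝ) ≤ r := by exact_mod_cast hk
      push_cast
      nlinarith [mul_nonneg (Nat.cast_nonneg (α := ℝ) N) hr0.le]
    rw [pow_succ, mul_comm ((1 / 2 : ℝ) ^ N), ← mul_assoc]
    gcongr
    linarith
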